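/- Let λ_1 ≥ λ_2 ≥ … ≥ λ_m > 0 be real numbers, let k be an integer with 1 ≤ k < m, let T = Σ_{i=k+1}^m λ_i, and let ε ∈ (0, 1). Then for every Δ ∈ [−εT, εT] the equation k·t = Σ_{i=1}^m min(t, λ_i) + Δ has a unique solution τ_Δ in the interval [λ_k, ∞); moreover |τ_0 − τ_Δ| ≤ |Δ|, where τ_0 is the solution for Δ = 0. -/

import Mathlib

open Finset

lemma card_aux {m : ℕ} (j : ℕ) (h : j ≤ m) :
    (Finset.univ.filter (fun i : Fin m => (i : ℕ) < j)).card = j := by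
  rw [Fin.card_filter_val_lt]; exact min_eq_right h

/-- existence, uniqueness, and Lipschitz dependence on Δ of the
threshold solving `k·t = Σ_i min(t, λ_i) + Δ` on `[λ_k, ∞)`. -/
theorem stmt9 {m : ℕ} (lam : Fin m → ℝ) (hpos : ∀ i, 0 < lam i)
    (hanti : Antitone lam) (k : ℕ) (hk1 : 1 ≤ k) (hkm : k < m)
    (T : ℝ) (hT : T = ∑ i ∈ Finset.univ.filter (fun i : Fin m => k ≤ (i : ℕ)), lam i)
    (ε : ℝ) (hε : ε ∈ Set.Ioo (0 : ℝ) 1) :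
    (∀ Δ ∈ Set.Icc (-(ε * T)) (ε * T),
      ∃! t : ℝ, t ∈ Set.Ici (lam ⟨k - 1, by omega⟩) ∧
        (k : ℝ) * t = (∑ i, min t (lam i)) + Δ) ∧
    (∀ Δ ∈ Set.Icc (-(ε * T)) (ε * T), ∀ τ₀ τΔ : ℝ,
      (τ₀ ∈ Set.Ici (lam ⟨k - 1, by omega⟩) ∧
        (k : ℝ) * τ₀ = ∑ i, min τ₀ (lam i)) →
      (τΔ ∈ Set.Ici (lam ⟨k - 1, by omega⟩) ∧
        (k : ℝ) * τΔ = (∑ i, min τΔ (lam i)) + Δ) →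
      |τ₀ - τΔ| ≤ |Δ|) := by
  have hcont : Continuous (fun t : ℝ => (k : ℝ) * t - ∑ i, min t (lam i)) := by fun_prop
  have ⟨a, ha⟩ : ∃ a, a = lam ⟨k - 1, by omega⟩ := ⟨_, rfl⟩
  rw [← ha]
  have hlow : ∀ i : Fin m, k - 1 ≤ (i : ℕ) → lam i ≤ a := fun i hi => by
    rw [ha]; exact hanti (Fin.mk_le_of_le_val hi)
  have hhigh : ∀ i : Fin m, (i : ℕ) < k → a ≤ lam i := fun i hi => by
    rw [ha]; exact hanti (Fin.le_def.2 (by simp; omega))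
  have hkey : ∀ s t : ℝ, a ≤ s → s ≤ t →
      t - s ≤ ((k : ℝ) * t - ∑ i, min t (lam i)) - ((k : ℝ) * s - ∑ i, min s (lam i)) := by
    intro s t has hst
    have h1 : ∑ i, (min t (lam i) - min s (lam i)) ≤
        ∑ i : Fin m, (if (i : ℕ) < k - 1 then t - s else 0) := by
      apply Finset.sum_le_sum
      intro i _
      split_ifs with h
      · rcases min_cases t (lam i) with h1 | h1 <;> rcases min_cases s (lam i) with h2 | h2 <;>
          linarith
      · have := hlow i (by omega)
        rw [min_eq_right (by linarith), min_eq_right (by linarith)]; linarith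
    rw [← Finset.sum_filter, Finset.sum_const, card_aux _ (by omega), Finset.sum_sub_distrib,
      nsmul_eq_mul, Nat.cast_sub hk1, Nat.cast_one] at h1
    linarith
  have hbase : ∑ i, min a (lam i) = k * a + T := by
    have h1 : ∀ i : Fin m, min a (lam i) =
        (if (i : ℕ) < k then a else 0) + (if k ≤ (i : ℕ) then lam i else 0) := by
      intro i
      by_cases h : (i : ℕ) < k
      · rw [if_pos h, if_neg (by omega), min_eq_left (hhigh i h), add_zero]
      · rw [if_neg h, if_pos (by omega), min_eq_right (hlow i (by omega)), zero_add]
    rw [Finset.sum_congr rfl (fun i _ => h1 i), Finset.sum_add_distrib, ← Finset.sum_filter,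
      ← Finset.sum_filter, Finset.sum_const, card_aux _ hkm.le, nsmul_eq_mul, hT]
  have hT0 : 0 ≤ T := by
    rw [hT]; exact Finset.sum_nonneg (fun i _ => (hpos i).le)
  have hεT : ε * T ≤ T := mul_le_of_le_one_left hT0 hε.2.le
  refine ⟨?_, ?_⟩
  · rintro Δ ⟨hΔ1, hΔ2⟩
    have hΔT : 0 ≤ T + Δ := by linarith
    have hb := hkey a (a + (T + Δ)) le_rfl (by linarith)
    have hivt := intermediate_value_Icc (show a ≤ a + (T + Δ) by linarith) hcont.continuousOn
    obtain ⟨t, ht, hte⟩ := hivt (show Δ ∈ Set.Icc _ _ from ⟨by linarith, by linarith⟩)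
    simp only at hte
    refine ⟨t, ⟨ht.1, by linarith⟩, ?_⟩
    rintro u ⟨hu, hue⟩
    rcases le_total u t with h | h
    · have := hkey u t hu h
      linarith
    · have := hkey t u ht.1 h
      linarith
  · rintro Δ _ τ₀ τΔ ⟨h0, h0e⟩ ⟨h1, h1e⟩
    rcases le_total τ₀ τΔ with h | h
    · have := hkey _ _ h0 h
      rw [abs_sub_comm, abs_of_nonneg (by linarith)]
      exact le_trans (by linarith) (le_abs_self Δ)
    · have := hkey _ _ h1 h
      rw [abs_of_nonneg (by linarith)]
      exact le_trans (by linarith) (neg_le_abs Δ)
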